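/- arXiv:2511.07906 — 3 statements merged into one kernel-verified Lean document; each statement's English description precedes it below -/
import Mathlib

section
/- Let (G,E) be a self-similar action and let α be a g-cycle for some g ∈ G. Set α₁ = α and g₁ = g⁻¹, and recursively define α_{n+1} = gₙ·αₙ and g_{n+1} = gₙ|_{αₙ}. Then s(αₙ) = r(α_{n+1}) for all n, so the concatenation α_∞ = α₁α₂α₃⋯ is a well-defined infinite path. Moreover, if α has no entrance, then α_∞ has no entrance and every finite path in r(α)E^* is a prefix of α_∞. -/
noncomputable section

attribute [local instance] Classical.propDecidable

/-- Raw algebraic data of an inverse semigroup with zero, together with a domain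
predicate singling out its genuine elements (the carrier may contain junk). -/
structure RawSem (T : Type) where
  mul : T → T → T
  star : T → T
  zero : T
  dom : T → Prop

namespace RawSem

variable {T : Type} (R : RawSem T)

/-- The natural partial order: `t ≤ u` iff `t = u ⬝ t* ⬝ t`. -/
def le (t u : T) : Prop := t = R.mul u (R.mul (R.star t) t)

/-- Nonzero idempotents (belonging to the domain). -/
def NzIdem (e : T) : Prop := R.dom e ∧ R.mul e e = e ∧ e ≠ R.zero

/-- `F` covers the idempotent `e`: every nonzero idempotent below `e` meets some `f ∈ F`. -/
def Covers (F : Set T) (e : T) : Prop :=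
  ∀ z, R.NzIdem z → R.le z e → ∃ f ∈ F, R.mul z f ≠ R.zero

/-- The set `F_t` of nonzero idempotents trivially fixed by `t`, i.e. `≤ t`. -/
def TrivFix (t : T) : Set T := {e | R.NzIdem e ∧ R.le e t}

/-- The idempotent `e` is fixed by `t`:
`(t ⬝ f ⬝ t*) ⬝ f ≠ 0` for every nonzero idempotent `f ≤ e`. -/
def FixedBy (e t : T) : Prop :=
  ∀ f, R.NzIdem f → R.le f e → R.mul (R.mul (R.mul t f) (R.star t)) f ≠ R.zero

/-- The inverse semigroup is closed. -/
def Closed : Prop :=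
  ∀ t, R.dom t → ∃ F : Finset T, ↑F ⊆ R.TrivFix t ∧ ∀ e ∈ R.TrivFix t, R.Covers ↑F e

/-- The inverse semigroup is topologically free. -/
def TopFree : Prop :=
  ∀ t e, R.dom t → R.NzIdem e → R.FixedBy e t → ∃ f ∈ R.TrivFix t, R.mul f e ≠ R.zero

/-- The inverse semigroup is effective. -/
def Effective : Prop :=
  ∀ t e, R.dom t → R.NzIdem e → R.FixedBy e t →
    ∃ F : Finset T, ↑F ⊆ R.TrivFix t ∧ R.Covers (↑F) e

/-- The inverse semigroup is minimal. -/
def Minimal : Prop :=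
  ∀ e f, R.NzIdem e → R.NzIdem f → ∃ Ts : Finset T, (∀ t ∈ Ts, R.dom t) ∧
    R.Covers ((fun t => R.mul (R.mul t f) (R.star t)) '' ↑Ts) e

/-- The inverse semigroup is quasi-fundamental. -/
def QuasiFund : Prop :=
  ∀ s t, R.dom s → R.dom t → s ≠ R.zero → t ≠ R.zero →
    (∀ e, R.NzIdem e → R.mul (R.mul s e) (R.star s) = R.mul (R.mul t e) (R.star t)) →
    ∃ u, R.dom u ∧ u ≠ R.zero ∧ R.le u s ∧ R.le u t

/-- The inverse semigroup is fundamental. -/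
def Fund : Prop :=
  ∀ s t, R.dom s → R.dom t →
    (∀ e, R.NzIdem e → R.mul (R.mul s e) (R.star s) = R.mul (R.mul t e) (R.star t)) → s = t

/-- The inverse semigroup is `E*`-unitary. -/
def EUnitary : Prop := ∀ t e, R.dom t → R.NzIdem e → R.le e t → R.mul t t = t

/-- The inverse semigroup is locally contracting. -/
def LocContr : Prop :=
  ∀ e, R.NzIdem e → ∃ s, R.dom s ∧ ∃ F : Finset T, ∃ f₀ ∈ F,
    (∀ f ∈ F, R.NzIdem f ∧ R.le f (R.mul e (R.mul (R.star s) s))) ∧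
    ∀ f ∈ F, R.Covers (↑F) (R.mul (R.mul s f) (R.star s)) ∧
      R.mul f₀ (R.mul (R.mul s f) (R.star s)) = R.zero

/-- The inverse semigroup is strongly locally contracting. -/
def StrLocContr : Prop :=
  ∀ e, R.NzIdem e → ∃ s f₀ f₁, R.dom s ∧ R.NzIdem f₀ ∧ R.NzIdem f₁ ∧
    R.le f₀ f₁ ∧ R.le f₁ (R.mul e (R.mul (R.star s) s)) ∧
    R.le (R.mul (R.mul s f₁) (R.star s)) f₁ ∧
    R.mul f₀ (R.mul (R.mul s f₁) (R.star s)) = R.zero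

end RawSem

/-- A self-similar action `(G, E)` of a discrete groupoid `G` on a directed graph `E`
sharing the vertex/unit set `V`, encoded by total operations together with axioms
that hold on composable inputs.  Arrows `g` have source `gs g` and range `gr g`;
edges `e` have source `es e` and range `er e`; `g · e` (written `act g e`) and
`g |_e` (written `res g e`) are meaningful when `gs g = er e`. -/
structure SSA where
  V : Type
  G : Type
  E : Type
  gs : G → V
  gr : G → V
  es : E → V
  er : E → V
  one : V → G
  mul : G → G → G
  inv : G → G
  act : G → E → E
  res : G → E → G
  gs_one : ∀ v, gs (one v) = v
  gr_one : ∀ v, gr (one v) = v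
  gs_mul : ∀ g h, gs g = gr h → gs (mul g h) = gs h
  gr_mul : ∀ g h, gs g = gr h → gr (mul g h) = gr g
  mul_assoc' : ∀ g h k, gs g = gr h → gs h = gr k → mul (mul g h) k = mul g (mul h k)
  one_mul' : ∀ g, mul (one (gr g)) g = g
  mul_one' : ∀ g, mul g (one (gs g)) = g
  gs_inv : ∀ g, gs (inv g) = gr g
  gr_inv : ∀ g, gr (inv g) = gs g
  mul_inv' : ∀ g, mul g (inv g) = one (gr g)
  inv_mul' : ∀ g, mul (inv g) g = one (gs g)
  er_act : ∀ g e, gs g = er e → er (act g e) = gr g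
  act_one : ∀ e, act (one (er e)) e = e
  act_mul : ∀ g h e, gs g = gr h → gs h = er e → act (mul g h) e = act g (act h e)
  gs_res : ∀ g e, gs g = er e → gs (res g e) = es e
  gr_res : ∀ g e, gs g = er e → gr (res g e) = es (act g e)
  res_mul : ∀ g h e, gs g = gr h → gs h = er e →
    res (mul g h) e = mul (res g (act h e)) (res h e)

namespace SSA

/-- Finite paths in the graph: `Pth S a b` is the type of paths with range `a`
and source `b`; `cons e p` is the path `e · p`. -/
inductive Pth (S : SSA) : S.V → S.V → Type
  | nil (v : S.V) : Pth S v v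
  | cons (e : S.E) {b : S.V} (p : Pth S (S.es e) b) : Pth S (S.er e) b

/-- The path category `E^*`, bundled: a finite path with its range and source. -/
structure Path (S : SSA) where
  rng : S.V
  src : S.V
  pth : S.Pth rng src

/-- Infinite paths: sequences of edges `e₁e₂⋯` with `es eᵢ = er e_{i+1}`. -/
structure InfPath (S : SSA) where
  seq : ℕ → S.E
  chain : ∀ n, S.es (seq n) = S.er (seq (n + 1))

/-- A twist `σ = (σ_G, σ_⋈)` of the self-similar action, with values in the
unit circle `𝕋 ⊆ ℂ`. -/
structure Twist (S : SSA) where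
  σG : S.G → S.G → ℂ
  σB : S.G → S.E → ℂ
  σG_unimod : ∀ g h, S.gs g = S.gr h → ‖σG g h‖ = 1
  σB_unimod : ∀ g e, S.gs g = S.er e → ‖σB g e‖ = 1
  σG_cocycle : ∀ g h k, S.gs g = S.gr h → S.gs h = S.gr k →
    σG g h * σG (S.mul g h) k = σG h k * σG g (S.mul h k)
  σG_one_left : ∀ g, σG (S.one (S.gr g)) g = 1
  σG_one_right : ∀ g, σG g (S.one (S.gs g)) = 1
  σB_one : ∀ e, σB (S.one (S.er e)) e = 1
  σB_cocycle : ∀ g h e, S.gs g = S.gr h → S.gs h = S.er e →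
    σB h e * (starRingEnd ℂ) (σB (S.mul g h) e) * σB g (S.act h e) =
      (starRingEnd ℂ) (σG (S.res g (S.act h e)) (S.res h e)) * σG g h

variable {S : SSA}

namespace Pth

def length : ∀ {a b : S.V}, S.Pth a b → ℕ
  | _, _, .nil _ => 0
  | _, _, .cons _ p => length p + 1

def toList : ∀ {a b : S.V}, S.Pth a b → List S.E
  | _, _, .nil _ => []
  | _, _, .cons e p => e :: toList p

def comp : ∀ {a b c : S.V}, S.Pth a b → S.Pth b c → S.Pth a c
  | _, _, _, .nil _, q => q
  | _, _, _, .cons e p, q => .cons e (comp p q)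

end Pth

def Path.length (p : Path S) : ℕ := p.pth.length

def Path.toList (p : Path S) : List S.E := p.pth.toList

/-- A vertex regarded as a path of length `0`. -/
def Path.vert (S : SSA) (v : S.V) : Path S := ⟨v, v, .nil v⟩

/-- An edge regarded as a path of length `1`. -/
def Path.ofEdge (S : SSA) (e : S.E) : Path S := ⟨S.er e, S.es e, .cons e (.nil (S.es e))⟩

/-- Concatenation of paths (junk -- the first path -- when not composable). -/
def Path.comp (p q : Path S) : Path S :=
  if h : p.src = q.rng then
    ⟨p.rng, q.src, Pth.comp (cast (congrArg (S.Pth p.rng) h) p.pth) q.pth⟩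
  else p

/-- `q` is a prefix of `p`, i.e. `p` extends `q`. -/
def IsPrefix (S : SSA) (q p : Path S) : Prop :=
  ∃ r : Path S, q.src = r.rng ∧ p = q.comp r

/-- Two paths are comparable if one is a prefix of the other. -/
def Comparable (S : SSA) (p q : Path S) : Prop := IsPrefix S p q ∨ IsPrefix S q p

/-- The extended left action of groupoid arrows on finite paths,
given by the recursive recipe `g · v = r g`, `g · (e μ) = (g · e) (g|_e · μ)`. -/
def pactAux (S : SSA) : ∀ {a b : S.V}, S.G → S.Pth a b → Path S
  | _, _, g, .nil _ => Path.vert S (S.gr g)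
  | _, _, g, .cons e p => (Path.ofEdge S (S.act g e)).comp (pactAux S (S.res g e) p)

/-- The extended left action `g · μ` on finite paths. -/
def pact (S : SSA) (g : S.G) (p : Path S) : Path S := pactAux S g p.pth

/-- The extended restriction map, given by `g|_v = g` and `g|_{e μ} = (g|_e)|_μ`. -/
def presAux (S : SSA) : ∀ {a b : S.V}, S.G → S.Pth a b → S.G
  | _, _, g, .nil _ => g
  | _, _, g, .cons e p => presAux S (S.res g e) p

/-- The extended restriction map `g |_μ` on finite paths. -/
def pres (S : SSA) (g : S.G) (p : Path S) : S.G := presAux S g p.pth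

/-- `g` strongly fixes the path `p` : `g · p = p` and `g|_p = s p`. -/
def SFix (S : SSA) (g : S.G) (p : Path S) : Prop :=
  S.gs g = p.rng ∧ pact S g p = p ∧ pres S g p = S.one p.src

/-- `p` is a minimal strongly `g`-fixed path. -/
def MinSFix (S : SSA) (g : S.G) (p : Path S) : Prop :=
  SFix S g p ∧ ∀ q : Path S, IsPrefix S q p → q ≠ p → ¬ SFix S g q

/-- `g` is a unit of the groupoid (an element of `G⁰`). -/
def IsUnitArrow (S : SSA) (g : S.G) : Prop := g = S.one (S.gs g)

/-- `g` fixes every path in `s(g)E^*`. -/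
def FixesAll (S : SSA) (g : S.G) : Prop :=
  ∀ p : Path S, p.rng = S.gs g → pact S g p = p

/-- Condition (Fin): every `g` admits at most finitely many minimal strongly
`g`-fixed paths. -/
def CondFin (S : SSA) : Prop := ∀ g : S.G, {p : Path S | MinSFix S g p}.Finite

/-- Condition (Evr): if `g` fixes every path in `s(g)E^*` then `g` strongly fixes
some path in `s(g)E^*`. -/
def CondEvr (S : SSA) : Prop := ∀ g : S.G, FixesAll S g → ∃ p : Path S, SFix S g p

/-- `p` is a `g`-cycle: a path of positive length with `g · s(p) = r(p)`. -/
def GCycle (S : SSA) (g : S.G) (p : Path S) : Prop :=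
  1 ≤ p.length ∧ S.gs g = p.src ∧ S.gr g = p.rng

/-- The vertex `v` receives at least two distinct edges. -/
def HasEntranceVert (S : SSA) (v : S.V) : Prop :=
  ∃ e f : S.E, e ≠ f ∧ S.er e = v ∧ S.er f = v

/-- Base vertices of a finite path. -/
def Path.baseVerts (p : Path S) : Set S.V :=
  insert p.rng {v : S.V | ∃ e ∈ p.toList, S.es e = v}

/-- A finite path has an entrance. -/
def Path.hasEntrance (p : Path S) : Prop := ∃ v ∈ p.baseVerts, HasEntranceVert S v

/-- Condition (Cyc): every `G`-cycle has an entrance. -/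
def CondCyc (S : SSA) : Prop := ∀ (g : S.G) (p : Path S), GCycle S g p → p.hasEntrance

/-- `g` has slack. -/
def HasSlack (S : SSA) (g : S.G) : Prop :=
  ∃ F : Finset (Path S), (∀ p ∈ F, SFix S g p) ∧
    ∀ q : Path S, q.rng = S.gs g → ∃ p ∈ F, Comparable S p q

/-- Condition (Sla): if `g` fixes every path in `s(g)E^*` then `g` has slack. -/
def CondSla (S : SSA) : Prop := ∀ g : S.G, FixesAll S g → HasSlack S g

def InfPath.rng (ξ : InfPath S) : S.V := S.er (ξ.seq 0)

/-- Base vertices of an infinite path. -/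
def InfPath.baseVerts (ξ : InfPath S) : Set S.V := {v : S.V | ∃ n, S.er (ξ.seq n) = v}

/-- An infinite path has an entrance. -/
def InfPath.hasEntrance (ξ : InfPath S) : Prop := ∃ v ∈ ξ.baseVerts, HasEntranceVert S v

/-- The finite path `p` is a prefix of the infinite path `ξ`. -/
def PrefixOfInf (S : SSA) (p : Path S) (ξ : InfPath S) : Prop :=
  p.rng = ξ.rng ∧ ∀ i : ℕ, i < p.length → p.toList[i]? = some (ξ.seq i)

/-- Finite or infinite paths. -/
abbrev GenPath (S : SSA) : Type := Path S ⊕ InfPath S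

/-- The finite path `p` is a prefix of the finite or infinite path `ξ`. -/
def GPrefix (S : SSA) (p : Path S) : GenPath S → Prop
  | .inl q => IsPrefix S p q
  | .inr ξ => PrefixOfInf S p ξ

/-- The set `vE¹` of edges received by the vertex `v`. -/
def recvSet (S : SSA) (v : S.V) : Set S.E := {e : S.E | S.er e = v}

/-- A vertex is singular if it is a source or an infinite receiver. -/
def Singular (S : SSA) (v : S.V) : Prop := recvSet S v = ∅ ∨ (recvSet S v).Infinite

/-- A vertex is regular if it is not singular. -/
def Regular (S : SSA) (v : S.V) : Prop := ¬ Singular S v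

/-- The preorder `v ≪ w`: there is `v'` with `vE^*v' ≠ ∅` and `v'Gw ≠ ∅`. -/
def ll (S : SSA) (v w : S.V) : Prop :=
  ∃ (p : Path S) (g : S.G), p.rng = v ∧ S.gr g = p.src ∧ S.gs g = w

/-- Cofinality of the self-similar action: for every boundary path (a finite path
with singular source, or an infinite path) and every vertex `v`, some base vertex
`w` of the path satisfies `v ≪ w`. -/
def Cofinal (S : SSA) : Prop :=
  (∀ p : Path S, Singular S p.src → ∀ v : S.V, ∃ w ∈ p.baseVerts, ll S v w) ∧
  (∀ ξ : InfPath S, ∀ v : S.V, ∃ w ∈ ξ.baseVerts, ll S v w)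

def Hereditary (S : SSA) (W : Set S.V) : Prop :=
  ∀ v ∈ W, ∀ p : Path S, p.rng = v → p.src ∈ W

def Saturated (S : SSA) (W : Set S.V) : Prop :=
  ∀ w : S.V, Regular S w → (∀ e : S.E, S.er e = w → S.es e ∈ W) → w ∈ W

def GInvariant (S : SSA) (W : Set S.V) : Prop := ∀ g : S.G, S.gs g ∈ W → S.gr g ∈ W

/-- `(G,E)`-invariant subsets of `E⁰`: `G`-invariant, hereditary and saturated. -/
def SSAInvariant (S : SSA) (W : Set S.V) : Prop :=
  GInvariant S W ∧ Hereditary S W ∧ Saturated S W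

/-- Condition (Con): every vertex is reachable from a `G`-cycle with an entrance. -/
def CondCon (S : SSA) : Prop :=
  ∀ v : S.V, ∃ p : Path S, p.rng = v ∧
    ∃ (g : S.G) (c : Path S), GCycle S g c ∧ c.hasEntrance ∧ p.src ∈ c.baseVerts

/-- The underlying set (with zero `none`) of the inverse semigroup `S(G,E)`. -/
abbrev SGE (S : SSA) : Type := Option (Path S × S.G × Path S)

/-- Well-formedness of a triple `(α, g, β)` : `r g = s α` and `s g = s β`. -/
def SGE.wf (S : SSA) : SGE S → Prop
  | none => True
  | some (α, g, β) => S.gr g = α.src ∧ S.gs g = β.src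

/-- The idempotent `f_α = (α, s α, α)`. -/
def fIdem (S : SSA) (α : Path S) : SGE S := some (α, S.one α.src, α)

/-- The involution `(α,g,β)* = (β,g⁻¹,α)` on `S(G,E)`. -/
def sgeStar (S : SSA) : SGE S → SGE S
  | none => none
  | some (α, g, β) => some (β, S.inv g, α)

/-- The multiplication of the inverse semigroup `S(G,E)`. -/
def sgeMul (S : SSA) : SGE S → SGE S → SGE S
  | none, _ => none
  | some _, none => none
  | some (α, g, β), some (γ, h, δ) =>
    if SGE.wf S (some (α, g, β)) ∧ SGE.wf S (some (γ, h, δ)) then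
      if h1 : ∃ β' : Path S, β.src = Path.rng β' ∧ γ = β.comp β' then
        some (α.comp (pact S g h1.choose), S.mul (pres S g h1.choose) h, δ)
      else if h2 : ∃ γ' : Path S, γ.src = Path.rng γ' ∧ β = γ.comp γ' then
        some (α, S.mul g (S.inv (pres S (S.inv h) h2.choose)),
          δ.comp (pact S (S.inv h) h2.choose))
      else none
    else none

/-- Membership in the subsemigroup `S₀(G,E)` (with zero): triples with `|α| = |β|`. -/
def domS0 (S : SSA) (x : SGE S) : Prop :=
  SGE.wf S x ∧ (x = none ∨ ∃ (α : Path S) (g : S.G) (β : Path S),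
    x = some (α, g, β) ∧ α.length = β.length)

/-- Membership in the subsemigroup `S₀₀(G,E)` (with zero): triples `(g·β, g|_β, β)`. -/
def domS00 (S : SSA) (x : SGE S) : Prop :=
  SGE.wf S x ∧ (x = none ∨ ∃ (g : S.G) (β : Path S),
    S.gs g = β.rng ∧ x = some (pact S g β, pres S g β, β))

/-- `S(G,E)` as raw inverse-semigroup data. -/
def sgeSem (S : SSA) : RawSem (SGE S) := ⟨sgeMul S, sgeStar S, none, SGE.wf S⟩

/-- `S₀(G,E)` as raw inverse-semigroup data. -/
def sgeSem0 (S : SSA) : RawSem (SGE S) := ⟨sgeMul S, sgeStar S, none, domS0 S⟩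

/-- `S₀₀(G,E)` as raw inverse-semigroup data. -/
def sgeSem00 (S : SSA) : RawSem (SGE S) := ⟨sgeMul S, sgeStar S, none, domS00 S⟩

/-- The inductive extension of `σ_⋈` to finite paths:
`σ_⋈(h, s h) = 1`, `σ_⋈(h, e μ) = σ_⋈(h, e) σ_⋈(h|_e, μ)`. -/
def twAux (S : SSA) (σB : S.G → S.E → ℂ) : ∀ {a b : S.V}, S.G → S.Pth a b → ℂ
  | _, _, _, .nil _ => 1
  | _, _, g, .cons e p => σB g e * twAux S σB (S.res g e) p

/-- The extension `σ_⋈ : G * E^* → 𝕋` of a twist to finite paths. -/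
def twP (S : SSA) (σB : S.G → S.E → ℂ) (g : S.G) (p : Path S) : ℂ := twAux S σB g p.pth

/-- The `2`-cocycle `ω_σ` on `S(G,E)` induced by a twist `σ` of `(G,E)`. -/
def omg (S : SSA) (T : Twist S) : SGE S → SGE S → ℂ := fun x y =>
  match x, y with
  | some (_, g, β), some (γ, h, _) =>
    if h1 : ∃ β' : Path S, β.src = Path.rng β' ∧ γ = β.comp β' then
      twP S T.σB g h1.choose * T.σG (pres S g h1.choose) h
    else if h2 : ∃ γ' : Path S, γ.src = Path.rng γ' ∧ β = γ.comp γ' then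
      T.σG g (S.inv (pres S (S.inv h) h2.choose)) * twP S T.σB h (pact S (S.inv h) h2.choose)
    else 1
  | _, _ => 1

end SSA

/-- The sequence `(αₙ, gₙ)` associated to a `g`-cycle `α`:
`(α₁, g₁) = (α, g⁻¹)`, `(α_{n+1}, g_{n+1}) = (gₙ · αₙ, gₙ|_{αₙ})`.
(Here `cycSeq S g α n = (α_{n+1}, g_{n+1})`.) -/
def cycSeq (S : SSA) (g : S.G) (α : SSA.Path S) : ℕ → SSA.Path S × S.G
  | 0 => (α, S.inv g)
  | n + 1 =>
    (SSA.pact S (cycSeq S g α n).2 (cycSeq S g α n).1,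
      SSA.pres S (cycSeq S g α n).2 (cycSeq S g α n).1)

/-- Finite concatenations: `catSeq S f n = (f 0)(f 1)⋯(f (n-1))`. -/
def catSeq (S : SSA) (f : ℕ → SSA.Path S) : ℕ → SSA.Path S
  | 0 => SSA.Path.vert S (f 0).rng
  | n + 1 => (catSeq S f n).comp (f n)

section helpers
open SSA

theorem aux_toList_comp (S : SSA) {a b c : S.V} (p : S.Pth a b) (q : S.Pth b c) :
    (p.comp q).toList = p.toList ++ q.toList := by
  induction p with
  | nil v => rfl
  | cons e p ih => simp [Pth.comp, Pth.toList, ih]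

theorem aux_length (S : SSA) {a b : S.V} (p : S.Pth a b) : p.toList.length = p.length := by
  induction p with
  | nil v => rfl
  | cons e p ih => simp [Pth.length, Pth.toList, ih]

theorem aux_comp (S : SSA) (p q : Path S) (h : p.src = q.rng) :
    (p.comp q).rng = p.rng ∧ (p.comp q).src = q.src ∧
      (p.comp q).toList = p.toList ++ q.toList := by
  obtain ⟨a, b, p⟩ := p
  obtain ⟨c, d, q⟩ := q
  obtain rfl : b = c := h
  have hc : Path.comp (S := S) ⟨a, b, p⟩ ⟨b, d, q⟩ = ⟨a, d, p.comp q⟩ := by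
    unfold Path.comp
    exact dif_pos rfl
  rw [hc]
  exact ⟨rfl, rfl, aux_toList_comp S p q⟩

theorem aux_pact (S : SSA) {a b : S.V} (p : S.Pth a b) : ∀ g : S.G, S.gs g = a →
    (pactAux S g p).rng = S.gr g ∧ (pactAux S g p).src = S.gr (presAux S g p) ∧
    S.gs (presAux S g p) = b ∧ (pactAux S g p).toList.length = p.toList.length ∧
    ∀ e' ∈ (pactAux S g p).toList, ∃ h, ∃ e ∈ p.toList, S.gs h = S.er e ∧ e' = S.act h e := by
  induction p with
  | nil v =>
    intro g hg
    refine ⟨rfl, rfl, hg, rfl, ?_⟩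
    intro e' he'
    simp [pactAux, Path.vert, Path.toList, Pth.toList] at he'
  | cons e p ih =>
    intro g hg
    obtain ⟨h1, h2, h3, h4, h5⟩ := ih (S.res g e) (S.gs_res g e hg)
    have hc : (Path.ofEdge S (S.act g e)).src = (pactAux S (S.res g e) p).rng := by
      rw [h1, S.gr_res g e hg]; rfl
    obtain ⟨c1, c2, c3⟩ := aux_comp S _ _ hc
    have hl : (Path.ofEdge S (S.act g e)).toList = [S.act g e] := rfl
    simp only [pactAux, presAux]
    refine ⟨?_, ?_, h3, ?_, ?_⟩
    · rw [c1]; exact S.er_act g e hg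
    · rw [c2, h2]
    · rw [c3, hl]; simp [h4, Pth.toList]
    · intro e' he'
      rw [c3, hl] at he'
      rcases List.mem_append.1 he' with h | h
      · exact ⟨g, e, by simp [Pth.toList], hg, by simpa using h⟩
      · obtain ⟨k, f, hf, hk⟩ := h5 e' h
        exact ⟨k, f, by simp [Pth.toList, hf], hk⟩

theorem aux_act_inv (S : SSA) (h : S.G) (e : S.E) (he : S.gs h = S.er e) :
    S.act (S.inv h) (S.act h e) = e := by
  rw [← S.act_mul _ _ _ (S.gs_inv h) he, S.inv_mul', he, S.act_one]

theorem aux_ent (S : SSA) (h : S.G) (H : HasEntranceVert S (S.gr h)) :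
    HasEntranceVert S (S.gs h) := by
  obtain ⟨e, f, hne, he, hf⟩ := H
  have hi : S.gs (S.inv (S.inv h)) = S.gs h := by rw [S.gs_inv, S.gr_inv]
  refine ⟨S.act (S.inv h) e, S.act (S.inv h) f, ?_, ?_, ?_⟩
  · intro heq
    apply hne
    rw [← aux_act_inv S (S.inv h) e (by rw [S.gs_inv, he]), heq,
      aux_act_inv S (S.inv h) f (by rw [S.gs_inv, hf])]
  · rw [S.er_act _ _ (by rw [S.gs_inv, he]), S.gr_inv]
  · rw [S.er_act _ _ (by rw [S.gs_inv, hf]), S.gr_inv]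

theorem aux_er_mem (S : SSA) {a b : S.V} (p : S.Pth a b) : ∀ e ∈ p.toList,
    S.er e = a ∨ ∃ e' ∈ p.toList, S.es e' = S.er e := by
  induction p with
  | nil v => intro e he; simp [Pth.toList] at he
  | cons f p ih =>
    intro e he
    rcases List.mem_cons.1 he with h | h
    · left; rw [h]
    · right
      rcases ih e h with h | ⟨e', h, h'⟩
      · exact ⟨f, by simp [Pth.toList], h.symm⟩
      · exact ⟨e', by simp [Pth.toList, h], h'⟩

theorem aux_head (S : SSA) {a b : S.V} (p : S.Pth a b) (e : S.E)
    (h : p.toList[0]? = some e) : S.er e = a := by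
  cases p with
  | nil v => simp [Pth.toList] at h
  | cons f p => simp [Pth.toList] at h; rw [h]

theorem aux_chain (S : SSA) {a b : S.V} (p : S.Pth a b) : ∀ (i : ℕ) (e f : S.E),
    p.toList[i]? = some e → p.toList[i+1]? = some f → S.es e = S.er f := by
  induction p with
  | nil v => intro i e f h; simp [Pth.toList] at h
  | cons c p ih =>
    intro i e f he hf
    simp only [Pth.toList, List.getElem?_cons_succ] at he hf
    cases i with
    | zero =>
      simp at he
      subst he
      exact (aux_head S p f hf).symm
    | succ i =>
      simp only [List.getElem?_cons_succ] at he
      exact ih i e f he hf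

theorem aux_prefix (S : SSA) (ξ : InfPath S) (hξ : ¬ ξ.hasEntrance) {a b : S.V}
    (p : S.Pth a b) : ∀ k, S.er (ξ.seq k) = a →
    ∀ i < p.length, p.toList[i]? = some (ξ.seq (k + i)) := by
  induction p with
  | nil v => intro k _ i hi; simp [Pth.length] at hi
  | cons e p ih =>
    intro k hk i hi
    have he : e = ξ.seq k := by
      by_contra hne
      exact hξ ⟨_, ⟨k, rfl⟩, e, ξ.seq k, hne, hk.symm, rfl⟩
    cases i with
    | zero => simp [Pth.toList, he]
    | succ i =>
      simp only [Pth.toList, List.getElem?_cons_succ]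
      rw [ih (k + 1) (by rw [← ξ.chain, he]) i (by simpa [Pth.length] using hi)]
      congr 2; omega

theorem aux_cyc (S : SSA) (g : S.G) (α : Path S) (hcyc : GCycle S g α) (n : ℕ) :
    S.gs (cycSeq S g α n).2 = (cycSeq S g α n).1.rng ∧
    S.gr (cycSeq S g α n).2 = (cycSeq S g α n).1.src := by
  induction n with
  | zero =>
    exact ⟨(S.gs_inv g).trans hcyc.2.2, (S.gr_inv g).trans hcyc.2.1⟩
  | succ n ih =>
    obtain ⟨h1, h2, h3, -, -⟩ := aux_pact S (cycSeq S g α n).1.pth (cycSeq S g α n).2 ih.1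
    exact ⟨h3.trans (ih.2.symm.trans h1.symm), h2.symm⟩

end helpers

/-- For a `g`-cycle `α`, the recursively defined sequence `αₙ`
satisfies `s(αₙ) = r(α_{n+1})`, each `αₙ` has positive length, and the
concatenation `α_∞ = α₁α₂α₃⋯` is a well-defined infinite path; moreover, if `α`
has no entrance then `α_∞` has no entrance and every finite path in `r(α)E^*` is
a prefix of `α_∞`. -/
theorem statement8 (S : SSA) (g : S.G) (α : SSA.Path S) (hcyc : SSA.GCycle S g α) :
    (∀ n : ℕ, (cycSeq S g α n).1.src = (cycSeq S g α (n + 1)).1.rng) ∧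
    (∀ n : ℕ, 1 ≤ (cycSeq S g α n).1.length) ∧
    ∃ ξ : SSA.InfPath S, ξ.rng = α.rng ∧
      (∀ n : ℕ, SSA.PrefixOfInf S (catSeq S (fun k => (cycSeq S g α k).1) n) ξ) ∧
      (¬ α.hasEntrance → ¬ ξ.hasEntrance ∧
        ∀ p : SSA.Path S, p.rng = α.rng → SSA.PrefixOfInf S p ξ) := by
  have hstep := fun n => aux_pact S (cycSeq S g α n).1.pth (cycSeq S g α n).2
    (aux_cyc S g α hcyc n).1
  have hA : ∀ n : ℕ, (cycSeq S g α n).1.src = (cycSeq S g α (n + 1)).1.rng := fun n =>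
    (aux_cyc S g α hcyc n).2.symm.trans (hstep n).1.symm
  have hB : ∀ n : ℕ, 1 ≤ (cycSeq S g α n).1.toList.length := by
    intro n
    induction n with
    | zero =>
      exact hcyc.1.trans (aux_length S α.pth).ge
    | succ n ih => exact ih.trans (hstep n).2.2.2.1.ge
  refine ⟨hA, fun n => (hB n).trans (aux_length S _).le, ?_⟩
  set f : ℕ → SSA.Path S := fun k => (cycSeq S g α k).1 with hf
  have hcat : ∀ n, (catSeq S f n).rng = α.rng ∧ (catSeq S f n).src = (f n).rng ∧
      n ≤ (catSeq S f n).toList.length := by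
    intro n
    induction n with
    | zero => exact ⟨rfl, rfl, Nat.zero_le _⟩
    | succ n ih =>
      obtain ⟨c1, c2, c3⟩ := aux_comp S (catSeq S f n) (f n) ih.2.1
      refine ⟨c1.trans ih.1, c2.trans (hA n), ?_⟩
      have := hB n
      simp only [catSeq]
      rw [c3, List.length_append]
      have h2 : 1 ≤ (f n).toList.length := hB n
      omega
  have hcatL : ∀ n, (catSeq S f (n+1)).toList = (catSeq S f n).toList ++ (f n).toList := fun n =>
    (aux_comp S (catSeq S f n) (f n) (hcat n).2.1).2.2
  have hmono : ∀ n k i : ℕ, i < (catSeq S f n).toList.length →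
      (catSeq S f (n + k)).toList[i]? = (catSeq S f n).toList[i]? := by
    intro n k i hi
    have : (catSeq S f n).toList <+: (catSeq S f (n + k)).toList := by
      induction k with
      | zero => exact List.prefix_refl _
      | succ k ih => exact ih.trans (by rw [← Nat.add_assoc, hcatL]; exact List.prefix_append _ _)
    obtain ⟨t, ht⟩ := this
    rw [← ht, List.getElem?_append_left hi]
  have hex : ∀ i : ℕ, ∃ e, (catSeq S f (i + 1)).toList[i]? = some e := fun i =>
    ⟨_, List.getElem?_eq_getElem (hcat (i + 1)).2.2⟩
  choose s hs using hex
  have hs' : ∀ n i : ℕ, i < (catSeq S f n).toList.length →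
      (catSeq S f n).toList[i]? = some (s i) := by
    intro n i hi
    rw [← hmono n (i + 1) i hi, Nat.add_comm, hmono (i + 1) n i (hcat (i + 1)).2.2, hs]
  let ξ : SSA.InfPath S := ⟨s, fun n => aux_chain S (catSeq S f (n + 2)).pth n _ _
    (hs' (n + 2) n (lt_of_lt_of_le (by omega) (hcat (n + 2)).2.2)) (hs (n + 1))⟩
  have hr : ξ.rng = α.rng := (aux_head S (catSeq S f 1).pth (s 0) (hs 0)).trans (hcat 1).1
  refine ⟨ξ, hr, ?_, ?_⟩
  · intro n
    refine ⟨(hcat n).1.trans hr.symm, fun i hi => hs' n i ?_⟩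
    exact lt_of_lt_of_le hi (aux_length S _).ge
  · intro hne
    have hNE : ∀ n, ∀ e ∈ (f n).toList, ¬ SSA.HasEntranceVert S (S.er e) := by
      intro n
      induction n with
      | zero =>
        intro e he H
        apply hne
        refine ⟨S.er e, ?_, H⟩
        exact aux_er_mem S α.pth e he
      | succ n ih =>
        intro e' he' H
        obtain ⟨h, e, he, hh, rfl⟩ := (hstep n).2.2.2.2 e' he'
        rw [S.er_act h e hh] at H
        exact ih e he (hh ▸ aux_ent S h H)
    have hNC : ∀ n, ∀ e ∈ (catSeq S f n).toList, ¬ SSA.HasEntranceVert S (S.er e) := by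
      intro n
      induction n with
      | zero =>
        intro e he
        simp [catSeq, SSA.Path.vert, SSA.Path.toList, SSA.Pth.toList] at he
      | succ n ih =>
        intro e he
        rw [hcatL] at he
        rcases List.mem_append.1 he with h | h
        · exact ih e h
        · exact hNE n e h
    have hξ : ¬ ξ.hasEntrance := by
      rintro ⟨v, ⟨n, rfl⟩, H⟩
      exact hNC (n + 1) (s n) (List.mem_of_getElem? (hs n)) H
    refine ⟨hξ, fun p hp => ⟨hp.trans hr.symm, fun i hi => ?_⟩⟩
    have := aux_prefix S ξ hξ p.pth 0 (hr.trans hp.symm) i hi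
    rwa [Nat.zero_add] at this

end
end

section
/- Let (G,E) be a self-similar action. The inverse semigroup S(G,E) is minimal if and only if (G,E) is cofinal. -/
noncomputable section

attribute [local instance] Classical.propDecidable

namespace SSA

section Helpers

variable {S : SSA}

theorem mk_eq_of_toList {a b : S.V} (p : S.Pth a b) : ∀ {a' b' : S.V} (q : S.Pth a' b'),
    a = a' → p.toList = q.toList → (⟨a, b, p⟩ : Path S) = ⟨a', b', q⟩ := by
  induction p with
  | nil v =>
    intro a' b' q h hl
    cases q with
    | nil _ => subst h; rfl
    | cons e q => simp [Pth.toList] at hl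
  | cons e p ih =>
    intro a' b' q h hl
    cases q with
    | nil _ => simp [Pth.toList] at hl
    | cons e' q =>
      simp only [Pth.toList, List.cons.injEq] at hl
      obtain ⟨he, hl⟩ := hl
      subst he
      have := ih q rfl hl
      injection this with h1 h2 h3
      subst h2
      have h3' := eq_of_heq h3
      subst h3'
      rfl

theorem path_ext {p q : Path S} (h : p.rng = q.rng) (hl : p.toList = q.toList) : p = q := by
  obtain ⟨a, b, p⟩ := p
  obtain ⟨a', b', q⟩ := q
  exact mk_eq_of_toList p q h hl

theorem pth_toList_comp {a b c : S.V} (p : S.Pth a b) (q : S.Pth b c) :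
    (p.comp q).toList = p.toList ++ q.toList := by
  induction p with
  | nil v => simp [Pth.comp, Pth.toList]
  | cons e p ih => simp [Pth.comp, Pth.toList, ih]

theorem comp_spec (p q : Path S) (h : p.src = q.rng) :
    (p.comp q).rng = p.rng ∧ (p.comp q).src = q.src ∧
      (p.comp q).toList = p.toList ++ q.toList := by
  obtain ⟨a, b, p⟩ := p
  obtain ⟨b', c, q⟩ := q
  simp only at h
  subst h
  have hc : (⟨a, b, p⟩ : Path S).comp ⟨b, c, q⟩ = ⟨a, c, p.comp q⟩ := by
    simp [Path.comp]
  rw [hc]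
  exact ⟨rfl, rfl, pth_toList_comp p q⟩

theorem comp_nil (p q : Path S) (h : p.src = q.rng) (hq : q.toList = []) : p.comp q = p := by
  obtain ⟨h1, h2, h3⟩ := comp_spec p q h
  exact path_ext h1 (by rw [h3, hq, List.append_nil])

theorem comp_cancel (p q q' : Path S) (h : p.src = q.rng) (h' : p.src = q'.rng)
    (he : p.comp q = p.comp q') : q = q' := by
  have h1 := (comp_spec p q h).2.2
  have h2 := (comp_spec p q' h').2.2
  rw [he, h2] at h1
  exact path_ext (h.symm.trans h') (List.append_cancel_left h1).symm

theorem nil_src (q : Path S) (hq : q.toList = []) : q.src = q.rng := by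
  obtain ⟨a, b, q⟩ := q
  cases q with
  | nil => rfl
  | cons e q => simp [Path.toList, Pth.toList] at hq

theorem isPrefix_spec {q p : Path S} (h : IsPrefix S q p) :
    q.rng = p.rng ∧ q.toList <+: p.toList := by
  obtain ⟨r, hr, rfl⟩ := h
  obtain ⟨h1, _, h3⟩ := comp_spec q r hr
  exact ⟨h1.symm, by rw [h3]; exact List.prefix_append _ _⟩

theorem exists_rest {a b : S.V} (q : S.Pth a b) : ∀ {a' c : S.V} (p : S.Pth a' c),
    a = a' → q.toList <+: p.toList → ∃ r : Path S, b = r.rng ∧ p.toList = q.toList ++ r.toList := by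
  induction q with
  | nil v =>
    intro a' c p h _
    exact ⟨⟨a', c, p⟩, h, rfl⟩
  | cons e q ih =>
    intro a' c p h hp
    cases p with
    | nil => simp [Pth.toList] at hp
    | cons e' p =>
      simp only [Pth.toList, List.cons_prefix_cons] at hp
      obtain ⟨rfl, hp⟩ := hp
      obtain ⟨r, h1, h2⟩ := ih p rfl hp
      exact ⟨r, h1, by simp [Pth.toList, h2]⟩

theorem isPrefix_of {q p : Path S} (h : q.rng = p.rng) (hl : q.toList <+: p.toList) :
    IsPrefix S q p := by
  obtain ⟨r, h1, h2⟩ := exists_rest q.pth p.pth h hl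
  refine ⟨r, h1, ?_⟩
  obtain ⟨h3, _, h5⟩ := comp_spec q r h1
  exact path_ext (h.symm.trans h3.symm) (by rw [h5]; exact h2)

/-- groupoid facts -/
theorem g_inv_one (v : S.V) : S.inv (S.one v) = S.one v := by
  have h1 := S.mul_inv' (S.one v)
  have h2 := S.one_mul' (S.inv (S.one v))
  rw [S.gr_inv, S.gs_one] at h2
  rw [S.gr_one] at h1
  exact h2.symm.trans h1

theorem g_idem (k : S.G) (h : S.gs k = S.gr k) (hk : S.mul k k = k) : k = S.one (S.gs k) := by
  have h1 := S.mul_assoc' (S.inv k) k k (S.gs_inv k) h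
  rw [hk, S.inv_mul', h, S.one_mul'] at h1
  rw [h]; exact h1

theorem g_inv_inv (g : S.G) : S.inv (S.inv g) = g := by
  have h1 := S.mul_assoc' g (S.inv g) (S.inv (S.inv g)) (S.gr_inv g).symm
    (S.gr_inv (S.inv g)).symm
  rw [S.mul_inv', S.mul_inv', S.gr_inv] at h1
  have h2 := S.one_mul' (S.inv (S.inv g))
  rw [S.gr_inv, S.gs_inv] at h2
  rw [h2, S.mul_one'] at h1
  exact h1

theorem res_one (e : S.E) : S.res (S.one (S.er e)) e = S.one (S.es e) := by
  have hs := S.gs_one (S.er e)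
  have h0 := S.one_mul' (S.one (S.er e))
  rw [S.gr_one] at h0
  have h1 := S.res_mul (S.one (S.er e)) (S.one (S.er e)) e (by rw [hs, S.gr_one]) hs
  rw [h0, S.act_one] at h1
  have h2 := S.gs_res _ e hs
  have h3 := S.gr_res _ e hs
  rw [S.act_one] at h3
  have := g_idem _ (h2.trans h3.symm) h1.symm
  rw [h2] at this
  exact this

theorem pactAux_spec {a b : S.V} (p : S.Pth a b) : ∀ (g : S.G), S.gs g = a →
    (pactAux S g p).rng = S.gr g ∧ (pactAux S g p).src = S.gr (presAux S g p) ∧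
      S.gs (presAux S g p) = b ∧ (pactAux S g p).toList.length = p.toList.length := by
  induction p with
  | nil v =>
    intro g hg
    simp [pactAux, presAux, Path.vert, Path.toList, Pth.toList, hg]
  | cons e p ih =>
    intro g hg
    obtain ⟨h1, h2, h3, h4⟩ := ih (S.res g e) (S.gs_res g e hg)
    have hc : (Path.ofEdge S (S.act g e)).src = (pactAux S (S.res g e) p).rng := by
      rw [h1, S.gr_res g e hg]; rfl
    obtain ⟨k1, k2, k3⟩ := comp_spec _ _ hc
    simp only [pactAux, presAux]
    refine ⟨?_, ?_, h3, ?_⟩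
    · rw [k1]; exact S.er_act g e hg
    · rw [k2, h2]
    · rw [k3, List.length_append, h4]
      simp [Path.ofEdge, Path.toList, Pth.toList, Nat.add_comm]

theorem pact_spec (g : S.G) (p : Path S) (h : S.gs g = p.rng) :
    (pact S g p).rng = S.gr g ∧ (pact S g p).src = S.gr (pres S g p) ∧
      S.gs (pres S g p) = p.src ∧ (pact S g p).toList.length = p.toList.length :=
  pactAux_spec p.pth g h

theorem pactAux_one {a b : S.V} (p : S.Pth a b) :
    pactAux S (S.one a) p = ⟨a, b, p⟩ ∧ presAux S (S.one a) p = S.one b := by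
  induction p with
  | nil v =>
    refine ⟨?_, rfl⟩
    show Path.vert S (S.gr (S.one v)) = Path.vert S v
    rw [S.gr_one]
  | cons e p ih =>
    simp only [pactAux, presAux, res_one, S.act_one]
    refine ⟨?_, ih.2⟩
    rw [ih.1]
    obtain ⟨k1, k2, k3⟩ := comp_spec (Path.ofEdge S e) ⟨S.es e, _, p⟩ rfl
    exact path_ext k1 (by rw [k3]; rfl)

theorem pact_one (p : Path S) : pact S (S.one p.rng) p = p := (pactAux_one p.pth).1

theorem pres_one (p : Path S) : pres S (S.one p.rng) p = S.one p.src := (pactAux_one p.pth).2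

theorem pres_nil (g : S.G) (p : Path S) (hp : p.toList = []) : pres S g p = g := by
  obtain ⟨a, b, p⟩ := p
  cases p with
  | nil => rfl
  | cons e q => simp [Path.toList, Pth.toList] at hp

theorem mulA {α β γ δ β' : Path S} {g h : S.G} (w1 : SGE.wf S (some (α, g, β)))
    (w2 : SGE.wf S (some (γ, h, δ))) (hc : β.src = β'.rng) (he : γ = β.comp β') :
    sgeMul S (some (α, g, β)) (some (γ, h, δ)) =
      some (α.comp (pact S g β'), S.mul (pres S g β') h, δ) := by
  have h1 : ∃ β' : Path S, β.src = Path.rng β' ∧ γ = β.comp β' := ⟨β', hc, he⟩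
  have hu : h1.choose = β' :=
    comp_cancel β _ _ h1.choose_spec.1 hc (h1.choose_spec.2.symm.trans he)
  simp only [sgeMul]
  rw [if_pos ⟨w1, w2⟩, dif_pos h1, hu]

theorem mulB {α β γ δ γ' : Path S} {g h : S.G} (w1 : SGE.wf S (some (α, g, β)))
    (w2 : SGE.wf S (some (γ, h, δ))) (hc : γ.src = γ'.rng) (he : β = γ.comp γ') :
    sgeMul S (some (α, g, β)) (some (γ, h, δ)) =
      some (α, S.mul g (S.inv (pres S (S.inv h) γ')), δ.comp (pact S (S.inv h) γ')) := by
  by_cases h1 : ∃ β' : Path S, β.src = Path.rng β' ∧ γ = β.comp β'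
  · obtain ⟨β', hc', he'⟩ := h1
    rw [mulA w1 w2 hc' he']
    have e1 := (comp_spec β β' hc').2.2
    have e2 := (comp_spec γ γ' hc).2.2
    rw [← he'] at e1
    rw [← he, e1, List.append_assoc] at e2
    have e3 := List.self_eq_append_right.1 e2
    obtain ⟨e4, e5⟩ := List.append_eq_nil_iff.1 e3
    rw [pres_nil _ _ e4, pres_nil _ _ e5, g_inv_inv]
    obtain ⟨k1, k2, k3, k4⟩ := pact_spec g β' (by rw [w1.2, hc'])
    obtain ⟨l1, l2, l3, l4⟩ := pact_spec (S.inv h) γ' (by rw [S.gs_inv, w2.1, hc])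
    rw [comp_nil α _ (by rw [k1, w1.1]) (by rw [e4] at k4; exact List.length_eq_zero_iff.1 k4),
      comp_nil δ _ (by rw [l1, S.gr_inv, w2.2])
        (by rw [e5] at l4; exact List.length_eq_zero_iff.1 l4)]
  · have h2 : ∃ γ' : Path S, γ.src = Path.rng γ' ∧ β = γ.comp γ' := ⟨γ', hc, he⟩
    have hu : h2.choose = γ' :=
      comp_cancel γ _ _ h2.choose_spec.1 hc (h2.choose_spec.2.symm.trans he)
    simp only [sgeMul]
    rw [if_pos ⟨w1, w2⟩, dif_neg h1, dif_pos h2, hu]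

theorem mul_comparable {α β γ δ : Path S} {g h : S.G}
    (hn : sgeMul S (some (α, g, β)) (some (γ, h, δ)) ≠ none) :
    SGE.wf S (some (α, g, β)) ∧ SGE.wf S (some (γ, h, δ)) ∧ Comparable S β γ := by
  by_contra hcon
  apply hn
  simp only [sgeMul]
  by_cases hw : SGE.wf S (some (α, g, β)) ∧ SGE.wf S (some (γ, h, δ))
  · rw [if_pos hw]
    have hc : ¬ Comparable S β γ := fun hc => hcon ⟨hw.1, hw.2, hc⟩
    have n1 : ¬ ∃ β' : Path S, β.src = Path.rng β' ∧ γ = β.comp β' := fun h => hc (Or.inl h)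
    have n2 : ¬ ∃ γ' : Path S, γ.src = Path.rng γ' ∧ β = γ.comp γ' := fun h => hc (Or.inr h)
    rw [dif_neg n1, dif_neg n2]
  · rw [if_neg hw]

theorem mul_ne_none {α β γ δ : Path S} {g h : S.G} (w1 : SGE.wf S (some (α, g, β)))
    (w2 : SGE.wf S (some (γ, h, δ))) (hc : Comparable S β γ) :
    sgeMul S (some (α, g, β)) (some (γ, h, δ)) ≠ none := by
  rcases hc with ⟨r, h1, h2⟩ | ⟨r, h1, h2⟩
  · rw [mulA w1 w2 h1 h2]; simp
  · rw [mulB w1 w2 h1 h2]; simp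

/-- Shape of a nonzero product. -/
theorem mul_shape {α β γ δ a b : Path S} {g h k : S.G}
    (hn : sgeMul S (some (α, g, β)) (some (γ, h, δ)) = some (a, k, b)) :
    SGE.wf S (some (a, k, b)) ∧ IsPrefix S α a ∧ IsPrefix S δ b := by
  obtain ⟨w1, w2, hc⟩ := mul_comparable (by rw [hn]; simp)
  rcases hc with ⟨r, h1, h2⟩ | ⟨r, h1, h2⟩
  · rw [mulA w1 w2 h1 h2] at hn
    simp only [Option.some.injEq, Prod.mk.injEq] at hn
    obtain ⟨rfl, rfl, rfl⟩ := hn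
    have hg : S.gs g = r.rng := by rw [w1.2, h1]
    obtain ⟨k1, k2, k3, k4⟩ := pact_spec g r hg
    have ha : α.src = (pact S g r).rng := by rw [k1, w1.1]
    have hm : S.gs (pres S g r) = S.gr h := by
      rw [k3, w2.1, h2, (comp_spec _ _ h1).2.1]
    refine ⟨⟨?_, ?_⟩, ⟨_, ha, rfl⟩, isPrefix_of rfl (List.prefix_refl _)⟩
    · rw [S.gr_mul _ _ hm, (comp_spec _ _ ha).2.1, k2]
    · rw [S.gs_mul _ _ hm, w2.2]
  · rw [mulB w1 w2 h1 h2] at hn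
    simp only [Option.some.injEq, Prod.mk.injEq] at hn
    obtain ⟨rfl, rfl, rfl⟩ := hn
    have hg : S.gs (S.inv h) = r.rng := by rw [S.gs_inv, w2.1, h1]
    obtain ⟨k1, k2, k3, k4⟩ := pact_spec (S.inv h) r hg
    have ha : δ.src = (pact S (S.inv h) r).rng := by rw [k1, S.gr_inv, w2.2]
    have hm : S.gs g = S.gr (S.inv (pres S (S.inv h) r)) := by
      rw [S.gr_inv, k3, w1.2, h2, (comp_spec _ _ h1).2.1]
    refine ⟨⟨?_, ?_⟩, isPrefix_of rfl (List.prefix_refl _), ⟨_, ha, rfl⟩⟩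
    · rw [S.gr_mul _ _ hm, w1.1]
    · rw [S.gs_mul _ _ hm, S.gs_inv, (comp_spec _ _ ha).2.1, k2]

theorem fIdem_wf (α : Path S) : SGE.wf S (fIdem S α) := ⟨S.gr_one _, S.gs_one _⟩

theorem fIdem_mul {η μ : Path S} (h : IsPrefix S η μ) :
    sgeMul S (fIdem S η) (fIdem S μ) = fIdem S μ := by
  obtain ⟨r, h1, h2⟩ := h
  have := mulA (fIdem_wf η) (fIdem_wf μ) h1 h2
  unfold fIdem at this ⊢
  rw [this, h1, pact_one, pres_one, ← h2]
  have h3 : μ.src = r.src := by rw [h2, (comp_spec _ _ h1).2.1]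
  have h4 := S.one_mul' (S.one r.src)
  rw [S.gr_one] at h4
  rw [h3, h4]

theorem fIdem_star (μ : Path S) : sgeStar S (fIdem S μ) = fIdem S μ := by
  simp [fIdem, sgeStar, g_inv_one]

theorem isPrefix_refl (μ : Path S) : IsPrefix S μ μ := isPrefix_of rfl (List.prefix_refl _)

theorem fIdem_nz (μ : Path S) : (sgeSem S).NzIdem (fIdem S μ) :=
  ⟨fIdem_wf μ, fIdem_mul (isPrefix_refl μ), by simp [fIdem, sgeSem]⟩

theorem fIdem_le_of {η μ : Path S} (h : IsPrefix S η μ) :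
    (sgeSem S).le (fIdem S μ) (fIdem S η) := by
  show fIdem S μ = sgeMul S (fIdem S η) (sgeMul S (sgeStar S (fIdem S μ)) (fIdem S μ))
  rw [fIdem_star, fIdem_mul (isPrefix_refl μ), fIdem_mul h]

theorem prefix_of_fIdem_le {η μ : Path S} (h : (sgeSem S).le (fIdem S μ) (fIdem S η)) :
    IsPrefix S η μ := by
  have h' : fIdem S μ = sgeMul S (fIdem S η) (sgeMul S (sgeStar S (fIdem S μ)) (fIdem S μ)) := h
  rw [fIdem_star, fIdem_mul (isPrefix_refl μ)] at h'
  exact (mul_shape h'.symm).2.1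

theorem nz_eq {z : SGE S} (hz : (sgeSem S).NzIdem z) : ∃ μ, z = fIdem S μ := by
  obtain ⟨w, hm, h0⟩ := hz
  match z, w, hm, h0 with
  | none, _, _, h0 => exact absurd rfl h0
  | some (a, k, b), w, hm, _ =>
    have hm' : sgeMul S (some (a, k, b)) (some (a, k, b)) = some (a, k, b) := hm
    have w' : SGE.wf S (some (a, k, b)) := w
    obtain ⟨w1, w2, hc⟩ := mul_comparable (by rw [hm']; simp)
    have hab : a = b := by
      rcases hc with ⟨r, h1, h2⟩ | ⟨r, h1, h2⟩
      · rw [mulA w1 w2 h1 h2] at hm'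
        simp only [Option.some.injEq, Prod.mk.injEq] at hm'
        have hg : S.gs k = r.rng := by rw [w1.2, h1]
        obtain ⟨k1, k2, k3, k4⟩ := pact_spec k r hg
        have ha : a.src = (pact S k r).rng := by rw [k1, w1.1]
        have h3 := (comp_spec _ _ ha).2.2
        rw [hm'.1] at h3
        rw [List.self_eq_append_right.1 h3] at k4
        rw [h2]
        exact comp_nil _ _ h1 (List.length_eq_zero_iff.1 k4.symm)
      · rw [mulB w1 w2 h1 h2] at hm'
        simp only [Option.some.injEq, Prod.mk.injEq] at hm'
        have hg : S.gs (S.inv k) = r.rng := by rw [S.gs_inv, w2.1, h1]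
        obtain ⟨k1, k2, k3, k4⟩ := pact_spec (S.inv k) r hg
        have ha : b.src = (pact S (S.inv k) r).rng := by rw [k1, S.gr_inv, w2.2]
        have h3 := (comp_spec _ _ ha).2.2
        rw [hm'.2.2] at h3
        rw [List.self_eq_append_right.1 h3] at k4
        rw [h2]
        exact (comp_nil _ _ h1 (List.length_eq_zero_iff.1 k4.symm)).symm
    subst hab
    have hr : IsPrefix S a a := isPrefix_refl a
    obtain ⟨r, h1, h2⟩ := hr
    have hnil : r.toList = [] := by
      have h3 := (comp_spec _ _ h1).2.2
      rw [← h2] at h3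
      exact List.self_eq_append_right.1 h3
    rw [mulA w1 w2 h1 h2] at hm'
    simp only [Option.some.injEq, Prod.mk.injEq] at hm'
    have hk := hm'.2.1
    rw [pres_nil _ _ hnil] at hk
    refine ⟨a, ?_⟩
    have := g_idem k (w1.2.trans w1.1.symm) hk
    rw [w1.2] at this
    rw [fIdem, ← this]

theorem ll_trans {v : S.V} {q : Path S} (h : ll S v q.rng) : ll S v q.src := by
  obtain ⟨p, g, h1, h2, h3⟩ := h
  obtain ⟨k1, k2, k3, k4⟩ := pact_spec g q h3
  obtain ⟨l1, l2, l3⟩ := comp_spec p (pact S g q) (by rw [k1, h2])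
  exact ⟨p.comp (pact S g q), pres S g q, l1.trans h1, by rw [l2, k2], k3⟩

theorem ll_prefix {v : S.V} {α a : Path S} (h : ll S v α.src) (hp : IsPrefix S α a) :
    ll S v a.src := by
  obtain ⟨r, h1, rfl⟩ := hp
  rw [(comp_spec _ _ h1).2.1]
  rw [h1] at h
  exact ll_trans h

/-- Conjugates of `f_β` are of the form expected. -/
theorem conj_shape {t : SGE S} {β μ : Path S}
    (h : sgeMul S (fIdem S μ) (sgeMul S (sgeMul S t (fIdem S β)) (sgeStar S t)) ≠ none) :
    ∃ (a : Path S) (k : S.G) (b : Path S),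
      sgeMul S (sgeMul S t (fIdem S β)) (sgeStar S t) = some (a, k, b) ∧
      Comparable S μ a ∧ ll S β.src a.src := by
  match t, h with
  | none, h => exact absurd (by simp [sgeMul, fIdem]) h
  | some (α, g, γ), h =>
    cases h1 : sgeMul S (some (α, g, γ)) (fIdem S β) with
    | none => rw [h1] at h; exact absurd (by simp [sgeMul, fIdem]) h
    | some x =>
      obtain ⟨a1, k1, b1⟩ := x
      rw [h1] at h
      cases h2 : sgeMul S (some (a1, k1, b1)) (sgeStar S (some (α, g, γ))) with
      | none => rw [h2] at h; exact absurd (by simp [sgeMul, fIdem]) h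
      | some y =>
        obtain ⟨a, k, b⟩ := y
        rw [h2] at h
        refine ⟨a, k, b, rfl, (mul_comparable h).2.2, ?_⟩
        obtain ⟨w1, _, p1⟩ := mul_shape h1
        obtain ⟨w2, p2, _⟩ := mul_shape h2
        refine ll_prefix ?_ p2
        obtain ⟨r, hr, hr'⟩ := p1
        refine ⟨r, S.inv k1, hr.symm, ?_, ?_⟩
        · rw [S.gr_inv, w1.2, hr', (comp_spec _ _ hr).2.1]
        · rw [S.gs_inv, w1.1]

theorem conj_exists {α β : Path S} (h : ll S β.src α.src) :
    ∃ t : SGE S, SGE.wf S t ∧ ∀ μ : Path S, Comparable S μ α →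
      sgeMul S (fIdem S μ) (sgeMul S (sgeMul S t (fIdem S β)) (sgeStar S t)) ≠ none := by
  obtain ⟨p, g, h1, h2, h3⟩ := h
  have hc := comp_spec β p h1.symm
  have wt : SGE.wf S (some (α, S.inv g, β.comp p)) :=
    ⟨by rw [S.gr_inv, h3], by rw [S.gs_inv, h2, hc.2.1]⟩
  refine ⟨some (α, S.inv g, β.comp p), wt, ?_⟩
  intro μ hμ
  have e1 := mulB wt (fIdem_wf β) h1.symm rfl
  rw [g_inv_one, ← h1, pact_one] at e1
  have w1 := (mul_shape e1).1
  have ws : SGE.wf S (some (β.comp p, S.inv (S.inv g), α)) := by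
    constructor
    · rw [S.gr_inv]; exact wt.2
    · rw [S.gs_inv]; exact wt.1
  obtain ⟨r, hr, hr'⟩ := isPrefix_refl (β.comp p)
  have hnil : r.toList = [] := by
    have h3 := (comp_spec _ _ hr).2.2
    rw [← hr'] at h3
    exact List.self_eq_append_right.1 h3
  have e2 := mulA w1 ws hr hr'
  have e1' : sgeMul S (some (α, S.inv g, β.comp p)) (fIdem S β) =
      some (α, S.mul (S.inv g) (S.inv (pres S (S.one p.rng) p)), β.comp p) := by
    unfold fIdem; rw [← h1]; exact e1
  obtain ⟨w3, ⟨q, hq, hq'⟩, _⟩ := mul_shape e2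
  obtain ⟨k1, k2, k3, k4⟩ := pact_spec _ r (w1.2.trans hr)
  rw [comp_nil α _ (by rw [k1, w1.1])
    (by rw [hnil] at k4; exact List.length_eq_zero_iff.1 k4)] at e2 w3
  rw [e1']
  simp only [sgeStar]
  rw [e2]
  exact mul_ne_none (fIdem_wf μ) w3 hμ

/-- Combinatorial form of minimality. -/
def CombMin (S : SSA) : Prop :=
  ∀ (η : Path S) (v : S.V), ∃ F : Finset (Path S), (∀ α ∈ F, ll S v α.src) ∧
    ∀ μ, IsPrefix S η μ → ∃ α ∈ F, Comparable S μ α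

theorem minimal_of_combMin (h : CombMin S) : (sgeSem S).Minimal := by
  intro e f he hf
  obtain ⟨η, rfl⟩ := nz_eq he
  obtain ⟨β, rfl⟩ := nz_eq hf
  obtain ⟨F, hF, hcov⟩ := h η β.src
  have hex : ∀ α : Path S, ∃ t : SGE S, ll S β.src α.src → SGE.wf S t ∧
      ∀ μ : Path S, Comparable S μ α →
      sgeMul S (fIdem S μ) (sgeMul S (sgeMul S t (fIdem S β)) (sgeStar S t)) ≠ none := by
    intro α
    by_cases hl : ll S β.src α.src
    · obtain ⟨t, ht⟩ := conj_exists hl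
      exact ⟨t, fun _ => ht⟩
    · exact ⟨none, fun h => absurd h hl⟩
  choose t ht using hex
  refine ⟨F.image t, ?_, ?_⟩
  · intro x hx
    obtain ⟨α, hα, rfl⟩ := Finset.mem_image.1 hx
    exact (ht α (hF α hα)).1
  · intro z hz hle
    obtain ⟨μ, rfl⟩ := nz_eq hz
    obtain ⟨α, hα, hc⟩ := hcov μ (prefix_of_fIdem_le hle)
    exact ⟨_, ⟨t α, Finset.mem_coe.2 (Finset.mem_image_of_mem t hα), rfl⟩,
      (ht α (hF α hα)).2 μ hc⟩

theorem combMin_of_minimal (h : (sgeSem S).Minimal) : CombMin S := by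
  intro η v
  obtain ⟨Ts, hT, hcov⟩ := h (fIdem S η) (fIdem S (Path.vert S v)) (fIdem_nz _) (fIdem_nz _)
  let G : SGE S → Path S := fun t =>
    match sgeMul S (sgeMul S t (fIdem S (Path.vert S v))) (sgeStar S t) with
    | none => η
    | some (a, _, _) => a
  refine ⟨(Ts.image G).filter (fun α => ll S v α.src), ?_, ?_⟩
  · intro α hα
    exact (Finset.mem_filter.1 hα).2
  · intro μ hμ
    obtain ⟨_, ⟨t, ht, rfl⟩, hne⟩ := hcov (fIdem S μ) (fIdem_nz μ) (fIdem_le_of hμ)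
    obtain ⟨a, k, b, h1, h2, h3⟩ := conj_shape hne
    have hG : G t = a := by simp only [G, h1]
    exact ⟨a, Finset.mem_filter.2 ⟨Finset.mem_image.2 ⟨t, ht, hG⟩, h3⟩, h2⟩

inductive Good (S : SSA) (v : S.V) : S.V → Prop
  | base (w : S.V) : ll S v w → Good S v w
  | step (w : S.V) : ¬ Singular S w → (∀ e, S.er e = w → Good S v (S.es e)) → Good S v w

theorem good_cover {v w : S.V} (h : Good S v w) : ∀ η : Path S, η.src = w →
    ∃ F : Finset (Path S), (∀ α ∈ F, ll S v α.src) ∧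
    ∀ μ, IsPrefix S η μ → ∃ α ∈ F, Comparable S μ α := by
  induction h with
  | base w h =>
    rintro η rfl
    refine ⟨{η}, by simpa using h, ?_⟩
    intro μ hμ
    exact ⟨η, by simp, Or.inr hμ⟩
  | step w hw _ ih =>
    rintro η rfl
    have hne : (recvSet S η.src) ≠ ∅ := fun h => hw (Or.inl h)
    have hfin : (recvSet S η.src).Finite := by
      by_contra hc; exact hw (Or.inr hc)
    have hex : ∀ e : S.E, ∃ F : Finset (Path S), S.er e = η.src →
        (∀ α ∈ F, ll S v α.src) ∧
        ∀ μ, IsPrefix S (η.comp (Path.ofEdge S e)) μ → ∃ α ∈ F, Comparable S μ α := by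
      intro e
      by_cases he : S.er e = η.src
      · obtain ⟨F, hF⟩ := ih e he (η.comp (Path.ofEdge S e)) (comp_spec _ _ he.symm).2.1
        exact ⟨F, fun _ => hF⟩
      · exact ⟨∅, fun h => absurd h he⟩
    choose F hF using hex
    refine ⟨hfin.toFinset.biUnion F, ?_, ?_⟩
    · intro α hα
      obtain ⟨e, he, hα⟩ := Finset.mem_biUnion.1 hα
      exact (hF e (hfin.mem_toFinset.1 he)).1 α hα
    · rintro μ ⟨r, hr, rfl⟩
      obtain ⟨c1, c2, c3⟩ := comp_spec η r hr
      cases hl : r.toList with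
      | nil =>
        rw [comp_nil _ _ hr hl]
        obtain ⟨e, he⟩ := Set.nonempty_iff_ne_empty.2 hne
        obtain ⟨α, hα, hc⟩ := (hF e he).2 _ (isPrefix_refl _)
        refine ⟨α, Finset.mem_biUnion.2 ⟨e, hfin.mem_toFinset.2 he, hα⟩, ?_⟩
        have he' : S.er e = η.src := he
        obtain ⟨d1, d2, d3⟩ := comp_spec η (Path.ofEdge S e) he'.symm
        have hp : η.toList <+: (η.comp (Path.ofEdge S e)).toList := by
          rw [d3]; exact List.prefix_append _ _
        rcases hc with hc | hc
        · obtain ⟨x1, x2⟩ := isPrefix_spec hc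
          exact Or.inl (isPrefix_of (d1.symm.trans x1) (hp.trans x2))
        · obtain ⟨x1, x2⟩ := isPrefix_spec hc
          rcases List.prefix_or_prefix_of_prefix hp x2 with y | y
          · exact Or.inl (isPrefix_of (d1.symm.trans x1.symm) y)
          · exact Or.inr (isPrefix_of (x1.trans d1) y)
      | cons e l =>
        have he : S.er e = r.rng := by
          obtain ⟨a, b, r⟩ := r
          cases r with
          | nil => simp [Path.toList, Pth.toList] at hl
          | cons e' r =>
            simp only [Path.toList, Pth.toList, List.cons.injEq] at hl
            exact congrArg S.er hl.1.symm
        have he' : S.er e = η.src := he.trans hr.symm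
        obtain ⟨d1, d2, d3⟩ := comp_spec η (Path.ofEdge S e) he'.symm
        have hp : IsPrefix S (η.comp (Path.ofEdge S e)) (η.comp r) := by
          refine isPrefix_of (d1.trans c1.symm) ?_
          rw [d3, c3, hl]
          exact ⟨l, by simp [Path.ofEdge, Path.toList, Pth.toList]⟩
        obtain ⟨α, hα, hc⟩ := (hF e he').2 _ hp
        exact ⟨α, Finset.mem_biUnion.2 ⟨e, hfin.mem_toFinset.2 he', hα⟩, hc⟩

theorem good_of_cofinal (h : Cofinal S) (v w : S.V) : Good S v w := by
  by_contra hw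
  have hstep : ∀ x : {w : S.V // ¬ Good S v w}, ∃ e : S.E, S.er e = x.1 ∧ ¬ Good S v (S.es e) := by
    rintro ⟨w, hw⟩
    by_contra hcon
    push Not at hcon
    apply hw
    by_cases hs : Singular S w
    · obtain ⟨w', hw', hl⟩ := h.1 (Path.vert S w) hs v
      have : w' = w := by
        simpa [Path.baseVerts, Path.vert, Path.toList, Pth.toList] using hw'
      subst this
      exact Good.base _ hl
    · exact Good.step w hs hcon
  choose f hf1 hf2 using hstep
  let W : ℕ → {w : S.V // ¬ Good S v w} := fun n =>
    Nat.rec ⟨w, hw⟩ (fun _ x => ⟨S.es (f x), hf2 x⟩) n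
  let ξ : InfPath S := ⟨fun n => f (W n), fun n => (hf1 (W (n + 1))).symm⟩
  obtain ⟨w', ⟨n, hn⟩, hl⟩ := h.2 ξ v
  have hn' : S.er (f (W n)) = w' := hn
  rw [hf1] at hn'
  rw [← hn'] at hl
  exact (W n).2 (Good.base _ hl)

theorem infPath_seg (ξ : InfPath S) (n : ℕ) : ∀ m : ℕ, ∃ p : Path S,
    p.rng = S.er (ξ.seq m) ∧ p.toList.length = n ∧ ∀ e ∈ p.toList, ∃ k, e = ξ.seq k := by
  induction n with
  | zero => intro m; exact ⟨Path.vert S _, rfl, rfl, by simp [Path.vert, Path.toList, Pth.toList]⟩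
  | succ n ih =>
    intro m
    obtain ⟨p, h1, h2, h3⟩ := ih (m + 1)
    have hc : (Path.ofEdge S (ξ.seq m)).src = p.rng := by rw [h1]; exact ξ.chain m
    obtain ⟨d1, d2, d3⟩ := comp_spec _ _ hc
    have hl : ((Path.ofEdge S (ξ.seq m)).comp p).toList = ξ.seq m :: p.toList := by
      rw [d3]; rfl
    refine ⟨(Path.ofEdge S (ξ.seq m)).comp p, d1, by rw [hl]; simp [h2], ?_⟩
    intro e he
    rw [hl] at he
    rcases List.mem_cons.1 he with rfl | he
    · exact ⟨m, rfl⟩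
    · exact h3 e he

theorem src_mem_aux {a b : S.V} (p : S.Pth a b) : b = a ∨ ∃ e ∈ p.toList, S.es e = b := by
  induction p with
  | nil => exact Or.inl rfl
  | cons e p ih =>
    right
    rcases ih with h | ⟨e', h1, h2⟩
    · exact ⟨e, by simp [Pth.toList], h.symm⟩
    · exact ⟨e', by simp [Pth.toList, h1], h2⟩

theorem src_mem (p : Path S) : p.src = p.rng ∨ ∃ e ∈ p.toList, S.es e = p.src :=
  src_mem_aux p.pth

theorem head_er (p : Path S) {e : S.E} {l : List S.E} (h : p.toList = e :: l) :
    S.er e = p.rng := by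
  obtain ⟨a, b, r⟩ := p
  cases r with
  | nil => simp [Path.toList, Pth.toList] at h
  | cons e' r =>
    simp only [Path.toList, Pth.toList, List.cons.injEq] at h
    exact congrArg S.er h.1.symm

theorem comparable_rng {p q : Path S} (h : Comparable S p q) : p.rng = q.rng := by
  rcases h with h | h
  · exact (isPrefix_spec h).1
  · exact (isPrefix_spec h).1.symm

theorem cofinal_of_combMin (h : CombMin S) : Cofinal S := by
  constructor
  · intro p hp v
    have hmem : p.src ∈ p.baseVerts := by
      rcases src_mem p with h | h
      · exact Or.inl h
      · exact Or.inr h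
    refine ⟨p.src, hmem, ?_⟩
    obtain ⟨F, hF, hcov⟩ := h (Path.vert S p.src) v
    rcases hp with hp | hp
    · obtain ⟨α, hα, hc⟩ := hcov _ (isPrefix_refl _)
      have hr : p.src = α.rng := comparable_rng hc
      have hnil : α.toList = [] := by
        cases hl : α.toList with
        | nil => rfl
        | cons e l =>
          have : e ∈ recvSet S p.src := (head_er α hl).trans hr.symm
          rw [hp] at this
          exact absurd this (Set.notMem_empty e)
      have := hF α hα
      rw [nil_src α hnil, ← hr] at this
      exact this
    · let H : Set S.E := {e | ∃ α ∈ F, ∃ l, α.toList = e :: l}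
      have hH : H.Finite := by
        have : H ⊆ ↑(F.biUnion (fun α => α.toList.toFinset)) := by
          rintro e ⟨α, hα, l, hl⟩
          simp only [Finset.coe_biUnion, Set.mem_iUnion]
          exact ⟨α, hα, by simp [hl]⟩
        exact (Finset.finite_toSet _).subset this
      obtain ⟨e, he, heH⟩ := (hp.sdiff hH).nonempty
      have he' : S.er e = p.src := he
      obtain ⟨α, hα, hc⟩ := hcov (Path.ofEdge S e)
        (isPrefix_of he'.symm (List.nil_prefix))
      have hr : p.src = α.rng := he'.symm.trans (comparable_rng hc)
      have hnil : α.toList = [] := by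
        cases hl : α.toList with
        | nil => rfl
        | cons e' l =>
          exfalso
          apply heH
          have hee : e = e' := by
            rcases hc with hc | hc
            · have := (isPrefix_spec hc).2
              rw [hl] at this
              exact (List.cons_prefix_cons.1 this).1
            · have := (isPrefix_spec hc).2
              rw [hl] at this
              exact (List.cons_prefix_cons.1 this).1.symm
          subst hee
          exact ⟨α, hα, l, hl⟩
      have := hF α hα
      rw [nil_src α hnil, ← hr] at this
      exact this
  · intro ξ v
    obtain ⟨F, hF, hcov⟩ := h (Path.vert S ξ.rng) v
    obtain ⟨z, h1, h2, h3⟩ := infPath_seg ξ (F.sup (fun α => α.toList.length) + 1) 0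
    obtain ⟨α, hα, hc⟩ := hcov z (isPrefix_of h1.symm (List.nil_prefix))
    refine ⟨α.src, ?_, hF α hα⟩
    have hle : α.toList.length ≤ F.sup (fun α => α.toList.length) :=
      Finset.le_sup (f := fun α : Path S => α.toList.length) hα
    rcases hc with hc | hc
    · have := (isPrefix_spec hc).2.length_le
      omega
    · obtain ⟨x1, x2⟩ := isPrefix_spec hc
      rcases src_mem α with hs | ⟨e, he, hs⟩
      · exact ⟨0, by rw [hs, x1, h1]⟩
      · obtain ⟨k, rfl⟩ := h3 e (x2.subset he)
        exact ⟨k + 1, by rw [← hs, ξ.chain k]⟩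

end Helpers

end SSA

/-- The inverse semigroup `S(G,E)` is minimal iff the self-similar
action `(G,E)` is cofinal. -/
theorem statement9 (S : SSA) : (SSA.sgeSem S).Minimal ↔ SSA.Cofinal S := by
  exact ⟨fun h => SSA.cofinal_of_combMin (SSA.combMin_of_minimal h),
    fun h => SSA.minimal_of_combMin fun η v =>
      SSA.good_cover (SSA.good_of_cofinal h v η.src) η rfl⟩

end
end

section
/- Let (G,E) be a self-similar action and fix v ∈ E⁰. Let H₀(v) = {w ∈ E⁰ : v ≪ w}, and for n ≥ 0 let H_{n+1}(v) be the union of H_n(v) and the G-orbits of all regular vertices w ∈ E⁰ such that s(e) ∈ H_n(v) for every e ∈ wE¹. Then every H_n(v) is ≪-upward closed (u ∈ H_n(v) and u ≪ w imply w ∈ H_n(v)), and H(v) = ⋃_{n≥0} H_n(v) is the smallest (G,E)-invariant subset of E⁰ containing v. -/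
noncomputable section

attribute [local instance] Classical.propDecidable

/-- One step of the saturation procedure: add the `G`-orbits of all regular
vertices all of whose received edges have sources in `A`. -/
def Hstep (S : SSA) (A : Set S.V) : Set S.V :=
  A ∪ {u : S.V | ∃ w : S.V, SSA.Regular S w ∧ (∀ e : S.E, S.er e = w → S.es e ∈ A) ∧
    ∃ g : S.G, S.gr g = u ∧ S.gs g = w}

/-- The sequence `H₀(v) = {w : v ≪ w}`, `H_{n+1}(v) = Hstep (Hₙ(v))`. -/
def Hseq (S : SSA) (v : S.V) : ℕ → Set S.V
  | 0 => {w : S.V | SSA.ll S v w}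
  | n + 1 => Hstep S (Hseq S v n)

/-- Closed under the groupoid action and under passing to sources of edges. -/
def Cl (S : SSA) (A : Set S.V) : Prop :=
  (∀ g : S.G, S.gs g ∈ A → S.gr g ∈ A) ∧ (∀ e : S.E, S.er e ∈ A → S.es e ∈ A)

theorem Cl.pth {S : SSA} {A : Set S.V} (h : Cl S A) {a b : S.V} (p : S.Pth a b) :
    a ∈ A → b ∈ A := by
  induction p with
  | nil v => exact id
  | cons e p ih => exact fun ha => ih (h.2 e ha)

theorem Cl.ll {S : SSA} {A : Set S.V} (h : Cl S A) {a b : S.V} (hab : SSA.ll S a b)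
    (ha : a ∈ A) : b ∈ A := by
  obtain ⟨p, g, rfl, h2, rfl⟩ := hab
  have h3 := h.pth p.pth ha
  rw [← h2, ← S.gs_inv] at h3
  have h4 := h.1 _ h3
  rwa [S.gr_inv] at h4

theorem Hseq_cl (S : SSA) (v : S.V) (n : ℕ) : Cl S (Hseq S v n) := by
  induction n with
  | zero =>
    constructor
    · rintro g ⟨p, h, h1, h2, h3⟩
      have hc : S.gs h = S.gr (S.inv g) := by rw [S.gr_inv, h3]
      exact ⟨p, S.mul h (S.inv g), h1, by rw [S.gr_mul _ _ hc, h2],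
        by rw [S.gs_mul _ _ hc, S.gs_inv]⟩
    · rintro e ⟨⟨a, b, p⟩, h, h1, h2, h3⟩
      have h4 : b = S.er (S.act h e) := by rw [S.er_act _ _ h3]; exact h2.symm
      subst h4
      exact ⟨⟨a, _, p.comp (.cons (S.act h e) (.nil _))⟩, S.res h e, h1,
        S.gr_res _ _ h3, S.gs_res _ _ h3⟩
  | succ n ih =>
    constructor
    · rintro g (hg | ⟨w, hw, he, h, h1, h2⟩)
      · exact Or.inl (ih.1 g hg)
      · exact Or.inr ⟨w, hw, he, S.mul g h, S.gr_mul _ _ h1.symm,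
          (S.gs_mul _ _ h1.symm).trans h2⟩
    · rintro e (hg | ⟨w, hw, he, h, h1, h2⟩)
      · exact Or.inl (ih.2 e hg)
      · left
        have hc : S.gs (S.inv h) = S.er e := by rw [S.gs_inv, h1]
        have h3 := he (S.act (S.inv h) e) (by rw [S.er_act _ _ hc, S.gr_inv, h2])
        rw [← S.gr_res _ _ hc, ← S.gs_inv] at h3
        have h4 := ih.1 _ h3
        rwa [S.gr_inv, S.gs_res _ _ hc] at h4

theorem Hseq_mono (S : SSA) (v : S.V) : Monotone (Hseq S v) :=
  monotone_nat_of_le_succ fun _ _ h => Or.inl h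

/-- Each `Hₙ(v)` is `≪`-upward closed, and
`H(v) = ⋃ₙ Hₙ(v)` is the smallest `(G,E)`-invariant subset of `E⁰` containing `v`. -/
theorem statement10 (S : SSA) (v : S.V) :
    (∀ n : ℕ, ∀ u ∈ Hseq S v n, ∀ w : S.V, SSA.ll S u w → w ∈ Hseq S v n) ∧
    (v ∈ ⋃ n : ℕ, Hseq S v n) ∧
    SSA.SSAInvariant S (⋃ n : ℕ, Hseq S v n) ∧
    (∀ W : Set S.V, SSA.SSAInvariant S W → v ∈ W → (⋃ n : ℕ, Hseq S v n) ⊆ W) := by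
  refine ⟨fun n u hu w h => (Hseq_cl S v n).ll h hu, ?_, ⟨?_, ?_, ?_⟩, ?_⟩
  · exact Set.mem_iUnion.2 ⟨0, ⟨v, v, .nil v⟩, S.one v, rfl, S.gr_one v, S.gs_one v⟩
  · intro g hg
    obtain ⟨n, hn⟩ := Set.mem_iUnion.1 hg
    exact Set.mem_iUnion.2 ⟨n, (Hseq_cl S v n).1 g hn⟩
  · rintro u hu p rfl
    obtain ⟨n, hn⟩ := Set.mem_iUnion.1 hu
    exact Set.mem_iUnion.2 ⟨n, (Hseq_cl S v n).pth p.pth hn⟩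
  · intro w hw he
    have hfin : (SSA.recvSet S w).Finite := by
      by_contra hc
      exact hw (Or.inr hc)
    have hN : ∃ N, ∀ e, S.er e = w → S.es e ∈ Hseq S v N := by
      have h1 : ∀ e, ∃ n, S.er e = w → S.es e ∈ Hseq S v n := by
        intro e
        by_cases h : S.er e = w
        · obtain ⟨n, hn⟩ := Set.mem_iUnion.1 (he e h)
          exact ⟨n, fun _ => hn⟩
        · exact ⟨0, fun h' => absurd h' h⟩
      choose f hf using h1
      refine ⟨hfin.toFinset.sup f, fun e h => ?_⟩
      exact Hseq_mono S v (Finset.le_sup (f := f) (hfin.mem_toFinset.2 h)) (hf e h)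
    obtain ⟨N, hN⟩ := hN
    exact Set.mem_iUnion.2 ⟨N + 1, Or.inr ⟨w, hw, hN, S.one w, S.gr_one w, S.gs_one w⟩⟩
  · rintro W ⟨hG, hH, hS⟩ hv
    have hcl : Cl S W := ⟨hG, fun e h => hH _ h (SSA.Path.ofEdge S e) rfl⟩
    refine Set.iUnion_subset fun n => ?_
    induction n with
    | zero => exact fun w hw => hcl.ll hw hv
    | succ n ih =>
      rintro u (hu | ⟨w, hw, he, g, rfl, rfl⟩)
      · exact ih hu
      · exact hG g (hS _ hw fun e h => ih (he e h))

end
end
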